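/- arXiv:2506.19322 — 5 statements merged into one kernel-verified Lean document; each statement's English description precedes it below -/
import Mathlib

section
/- Let α₁,…,αₙ ∈ ℤ^d be linearly independent integer vectors and θ ⊆ {1,…,n}. Let A[(θ→−1)] denote the tuple obtained from (α₁,…,αₙ) by replacing α_i with −α_i for each i ∈ θ. Then, in the fraction field F, σ(𝒞^θ(α₁,…,αₙ)) = (−1)^{|θ|} · σ(𝒞(A[(θ→−1)])). -/
noncomputable section
open scoped BigOperators

/-- The group algebra `ℚ[ℤ^d]` (Laurent polynomials in `d` variables over `ℚ`). -/
abbrev GroupAlg (d : ℕ) : Type := AddMonoidAlgebra ℚ (Fin d → ℤ)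

instance (d : ℕ) : IsDomain (GroupAlg d) := NoZeroDivisors.to_isDomain _

/-- The fraction field `F` of `ℚ[ℤ^d]`. -/
abbrev FracF (d : ℕ) : Type := FractionRing (GroupAlg d)

/-- The monomial `x^m` for `m ∈ ℤ^d`, viewed inside the fraction field. -/
def xpow {d : ℕ} (m : Fin d → ℤ) : FracF d :=
  algebraMap (GroupAlg d) (FracF d) (AddMonoidAlgebra.single m 1)

/-- The lattice points of the half-open fundamental parallelepiped `Π^θ` of the
tuple `b = (b₁,…,bₙ)`: points `Σ tᵢ bᵢ` with `tᵢ ∈ [0,1)` for `i ∉ θ` and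
`tᵢ ∈ (0,1]` for `i ∈ θ`. -/
def parPts {d n : ℕ} (b : Fin n → Fin d → ℤ) (θ : Finset (Fin n)) : Set (Fin d → ℤ) :=
  {m | ∃ t : Fin n → ℝ,
    (∀ i ∉ θ, 0 ≤ t i ∧ t i < 1) ∧ (∀ i ∈ θ, 0 < t i ∧ t i ≤ 1) ∧
    (fun j => (m j : ℝ)) = ∑ i, t i • (fun j => (b i j : ℝ))}

/-- The rational generating function `σ(𝒞^θ(b₁,…,bₙ))
  = (Σ_{m ∈ Π^θ ∩ ℤ^d} x^m) / ∏ᵢ (1 − x^{bᵢ}) ∈ F`. -/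
def sigmaGF {d n : ℕ} (b : Fin n → Fin d → ℤ) (θ : Finset (Fin n)) : FracF d :=
  (∑ᶠ m ∈ parPts b θ, xpow m) / ∏ i, (1 - xpow (b i))

theorem xpow_add' {d : ℕ} (a b : Fin d → ℤ) : xpow (a + b) = xpow a * xpow b := by
  unfold xpow
  rw [← map_mul, AddMonoidAlgebra.single_mul_single, one_mul]

theorem xpow_zero' {d : ℕ} : xpow (0 : Fin d → ℤ) = 1 := by
  unfold xpow
  exact map_one (algebraMap (GroupAlg d) (FracF d))

theorem xpow_ne' {d : ℕ} (a : Fin d → ℤ) : xpow a ≠ 0 := by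
  intro h
  have := xpow_add' a (-a)
  rw [add_neg_cancel, xpow_zero', h, zero_mul] at this
  exact one_ne_zero this

theorem xpow_sum' {d n : ℕ} (α : Fin n → Fin d → ℤ) (θ : Finset (Fin n)) :
    xpow (∑ i ∈ θ, α i) = ∏ i ∈ θ, xpow (α i) := by
  induction θ using Finset.induction_on with
  | empty => simp [xpow_zero']
  | insert a s ha ih => rw [Finset.sum_insert ha, Finset.prod_insert ha, xpow_add', ih]

theorem sum_shift {d n : ℕ} (α : Fin n → Fin d → ℤ) (θ : Finset (Fin n)) (t u : Fin n → ℝ)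
    (m : Fin d → ℤ) (h1 : ∀ i ∈ θ, t i + u i = 1) (h2 : ∀ i ∉ θ, t i = u i) :
    ((fun j => ((m + ∑ i ∈ θ, α i) j : ℝ)) = ∑ i, t i • (fun j => (α i j : ℝ))) ↔
    ((fun j => (m j : ℝ)) =
      ∑ i, u i • (fun j => (((if i ∈ θ then -α i else α i) : Fin d → ℤ) j : ℝ))) := by
  rw [funext_iff, funext_iff]
  refine forall_congr' fun j => ?_
  have key : ∑ i, t i * (α i j : ℝ) =
      ∑ i, u i * (((if i ∈ θ then -α i else α i) : Fin d → ℤ) j : ℝ) + ∑ i ∈ θ, (α i j : ℝ) := by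
    rw [← Finset.sum_ite_mem_eq θ (fun i => (α i j : ℝ)), ← Finset.sum_add_distrib]
    refine Finset.sum_congr rfl fun i _ => ?_
    by_cases hi : i ∈ θ
    · have := h1 i hi
      have h3 : t i = 1 - u i := by linarith
      simp [hi, h3]; ring
    · simp [hi, h2 i hi]
  simp only [Finset.sum_apply, Pi.smul_apply, smul_eq_mul, Pi.add_apply, Int.cast_add,
    Int.cast_sum]
  rw [key]
  exact add_left_inj _

theorem parPts_shift {d n : ℕ} (α : Fin n → Fin d → ℤ) (θ : Finset (Fin n)) (m : Fin d → ℤ) :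
    m + ∑ i ∈ θ, α i ∈ parPts α θ ↔
      m ∈ parPts (fun m => if m ∈ θ then -α m else α m) ∅ := by
  constructor
  · rintro ⟨t, h1, h2, h3⟩
    refine ⟨fun i => if i ∈ θ then 1 - t i else t i, ?_, by simp, ?_⟩
    · intro i _
      by_cases hi : i ∈ θ
      · have := h2 i hi
        simp only [hi, if_true]
        constructor <;> linarith
      · simpa [hi] using h1 i hi
    · refine (sum_shift α θ t _ m ?_ ?_).1 h3 <;> intro i hi <;> simp [hi]
  · rintro ⟨t, h1, -, h3⟩
    refine ⟨fun i => if i ∈ θ then 1 - t i else t i, ?_, ?_, ?_⟩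
    · intro i hi
      simpa [hi] using h1 i (by simp)
    · intro i hi
      have := h1 i (by simp)
      simp only [hi, if_true]
      constructor <;> linarith
    · refine (sum_shift α θ _ t m ?_ ?_).2 h3 <;> intro i hi <;> simp [hi]

theorem num_shift {d n : ℕ} (α : Fin n → Fin d → ℤ) (θ : Finset (Fin n)) :
    (∑ᶠ m ∈ parPts α θ, xpow m) = xpow (∑ i ∈ θ, α i) *
      ∑ᶠ m ∈ parPts (fun m => if m ∈ θ then -α m else α m) ∅, xpow m := by
  rw [← finsum_comp_equiv (Equiv.addRight (∑ i ∈ θ, α i)), ← smul_eq_mul, smul_finsum]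
  refine finsum_congr fun m => ?_
  rw [smul_finsum]
  simp only [Equiv.coe_addRight, parPts_shift, xpow_add', smul_eq_mul, mul_comm]

theorem den_shift {d n : ℕ} (α : Fin n → Fin d → ℤ) (θ : Finset (Fin n)) :
    (∏ i, (1 - xpow (α i))) = (-1) ^ θ.card * xpow (∑ i ∈ θ, α i) *
      ∏ i, (1 - xpow ((fun m => if m ∈ θ then -α m else α m) i)) := by
  rw [xpow_sum', ← Finset.prod_const, ← Finset.prod_mul_distrib,
    ← Finset.prod_ite_mem_eq θ, ← Finset.prod_mul_distrib]
  refine Finset.prod_congr rfl fun i _ => ?_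
  by_cases hi : i ∈ θ
  · have := xpow_add' (α i) (-α i)
    rw [add_neg_cancel, xpow_zero'] at this
    simp only [hi, if_true]
    linear_combination this
  · simp [hi]

/-- Lemma 3.4(ii) / Proposition 3.9: `σ(𝒞^θ(A)) = (−1)^{|θ|} σ(𝒞(A[(θ→−1)]))`. -/
theorem sigma_halfopen_eq_neg_closed {d n : ℕ} (α : Fin n → Fin d → ℤ)
    (hα : LinearIndependent ℤ α) (θ : Finset (Fin n)) :
    sigmaGF α θ =
      (-1 : FracF d) ^ θ.card * sigmaGF (fun m => if m ∈ θ then -α m else α m) ∅ := by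
  unfold sigmaGF
  rw [num_shift, den_shift α θ]
  have hx := xpow_ne' (∑ i ∈ θ, α i)
  have h1 : ((-1 : FracF d) ^ θ.card) * (-1) ^ θ.card = 1 := by
    rw [← mul_pow]; simp
  have h0 : (-1 : FracF d) ^ θ.card ≠ 0 := left_ne_zero_of_mul_eq_one h1
  have h2 : ((-1 : FracF d) ^ θ.card)⁻¹ = (-1) ^ θ.card := inv_eq_of_mul_eq_one_left h1
  rw [mul_comm ((-1 : FracF d) ^ θ.card) (xpow _), mul_assoc, mul_div_mul_left _ _ hx,
    div_eq_mul_inv, mul_inv, h2, div_eq_mul_inv]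
  ring
end
end

section
/- Let α₁,…,αₙ be linearly independent vectors in ℝ^d, let 1 ≤ r ≤ n, and let γ = Σ_{i=1}^r k_i α_i with k_i > 0 for all i. For 1 ≤ i ≤ r set K_i := 𝒞^{{1,…,i−1}}(α₁,…,α_{i−1},γ,α_{i+1},…,αₙ) (the half-open cone obtained by replacing the i-th generator by γ and opening the facets indexed by 1,…,i−1). Then the sets K₁,…,K_r are pairwise disjoint and their union equals the closed cone K = 𝒞(α₁,…,αₙ). -/
noncomputable section
open scoped BigOperators

/-- The half-open simplicial cone `𝒞^θ(α₁,…,αₙ)`: all points `Σ tᵢ αᵢ` with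
`tᵢ ≥ 0` for `i ∉ θ` and `tᵢ > 0` for `i ∈ θ`.  For `θ = ∅` this is the closed
simplicial cone `𝒞(α₁,…,αₙ)`. -/
def hoCone {d n : ℕ} (α : Fin n → Fin d → ℝ) (θ : Finset (Fin n)) : Set (Fin d → ℝ) :=
  {x | ∃ t : Fin n → ℝ, (∀ i ∉ θ, 0 ≤ t i) ∧ (∀ i ∈ θ, 0 < t i) ∧ x = ∑ i, t i • α i}

/-- Coordinates of a half-open cone with `i`-th generator replaced by `γ`. -/
theorem hoCone_update_iff {d n : ℕ} (α : Fin n → Fin d → ℝ) (e : Fin n → ℝ)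
    (γ : Fin d → ℝ) (hγ : γ = ∑ m, e m • α m) (i : Fin n) (hi : 0 < e i) (x : Fin d → ℝ) :
    x ∈ hoCone (Function.update α i γ)
      (Finset.univ.filter (fun m : Fin n => (m : ℕ) < (i : ℕ))) ↔
    ∃ s : Fin n → ℝ, x = ∑ m, s m • α m ∧ 0 ≤ s i ∧
      (∀ m, m < i → s i / e i * e m < s m) ∧ (∀ m, i < m → s i / e i * e m ≤ s m) := by
  have key : ∀ t : Fin n → ℝ, ∑ m, t m • Function.update α i γ m =
      ∑ m, ((if m = i then 0 else t m) + t i * e m) • α m := by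
    intro t
    have h1 : ∀ m, t m • Function.update α i γ m =
        (if m = i then (0 : ℝ) else t m) • α m + (if m = i then t i • γ else 0) := by
      intro m
      by_cases h : m = i
      · subst h; simp
      · simp [h]
    simp only [h1, Finset.sum_add_distrib, add_smul]
    congr 1
    simp [hγ, Finset.smul_sum, mul_smul]
  constructor
  · rintro ⟨t, h0, h1, rfl⟩
    have hti : 0 ≤ t i := h0 i (by simp)
    refine ⟨_, key t, ?_, ?_, ?_⟩
    · simp only [if_true, zero_add]; positivity
    · intro m hm
      have := h1 m (by simpa using hm)
      simp only [if_true, zero_add, hm.ne, if_false]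
      rw [mul_div_assoc, div_self hi.ne']; linarith
    · intro m hm
      have := h0 m (by simpa using hm.le)
      simp only [if_true, zero_add, hm.ne', if_false]
      rw [mul_div_assoc, div_self hi.ne']; linarith
  · rintro ⟨s, rfl, h0, h1, h2⟩
    have hq : 0 ≤ s i / e i := by positivity
    refine ⟨fun m => if m = i then s i / e i else s m - s i / e i * e m, ?_, ?_, ?_⟩
    · intro m hm
      have hm : i ≤ m := by simpa using hm
      rcases hm.eq_or_lt with h | h
      · simpa [h] using h ▸ hq
      · have := h2 m h
        simp only [h.ne', if_false]; linarith
    · intro m hm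
      have hm : m < i := by simpa using hm
      have := h1 m hm
      simp only [hm.ne, if_false]; linarith
    · rw [key]
      refine Finset.sum_congr rfl fun m _ => ?_
      congr 1
      by_cases h : m = i
      · subst h; simp [hi.ne']
      · simp [h]

/-- Proposition 3.6: for an interior direction `γ = Σ_{i≤r} kᵢαᵢ` (`kᵢ > 0`), the
half-open cones `Kᵢ = 𝒞^{{1,…,i−1}}(A[(i→γ)])`, `1 ≤ i ≤ r`, are pairwise disjoint
and their union is the closed cone `𝒞(α₁,…,αₙ)`. -/
theorem interior_point_partition {d n : ℕ} (α : Fin n → Fin d → ℝ)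
    (hα : LinearIndependent ℝ α) (r : ℕ) (hr1 : 1 ≤ r) (hrn : r ≤ n)
    (c : Fin n → ℝ) (hc : ∀ i : Fin n, (i : ℕ) < r → 0 < c i)
    (γ : Fin d → ℝ)
    (hγ : γ = ∑ i ∈ Finset.univ.filter (fun i : Fin n => (i : ℕ) < r), c i • α i) :
    (∀ i j : Fin n, (i : ℕ) < r → (j : ℕ) < r → i ≠ j →
      Disjoint
        (hoCone (Function.update α i γ)
          (Finset.univ.filter (fun m : Fin n => (m : ℕ) < (i : ℕ))))
        (hoCone (Function.update α j γ)
          (Finset.univ.filter (fun m : Fin n => (m : ℕ) < (j : ℕ))))) ∧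
    (⋃ i ∈ {i : Fin n | (i : ℕ) < r},
        hoCone (Function.update α i γ)
          (Finset.univ.filter (fun m : Fin n => (m : ℕ) < (i : ℕ))))
      = hoCone α ∅ := by
  classical
  set e : Fin n → ℝ := fun m => if (m : ℕ) < r then c m else 0 with he
  have hγ' : γ = ∑ m, e m • α m := by
    rw [hγ, Finset.sum_filter]
    refine Finset.sum_congr rfl fun m _ => ?_
    simp only [he]; split_ifs <;> simp
  have hpos : ∀ i : Fin n, (i : ℕ) < r → 0 < e i := fun i hi => by
    simp only [he, hi, if_true]; exact hc i hi
  have hnn : ∀ i, 0 ≤ e i := fun i => by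
    by_cases h : (i : ℕ) < r
    · exact (hpos i h).le
    · simp [he, h]
  have hlt : ∀ i j : Fin n, (i : ℕ) < r → (j : ℕ) < r → i < j →
      Disjoint
        (hoCone (Function.update α i γ)
          (Finset.univ.filter (fun m : Fin n => (m : ℕ) < (i : ℕ))))
        (hoCone (Function.update α j γ)
          (Finset.univ.filter (fun m : Fin n => (m : ℕ) < (j : ℕ)))) := by
    intro i j hi hj hij
    rw [Set.disjoint_left]
    intro x hx hy
    rw [hoCone_update_iff α e γ hγ' _ (hpos _ hi)] at hx
    rw [hoCone_update_iff α e γ hγ' _ (hpos _ hj)] at hy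
    obtain ⟨s, hs, -, -, h2⟩ := hx
    obtain ⟨t, ht, -, h1, -⟩ := hy
    have hst : s = t := by
      funext m
      have h0 : ∑ m, (s m - t m) • α m = 0 := by
        simp only [sub_smul, Finset.sum_sub_distrib]; rw [← hs, ← ht, sub_self]
      have := Fintype.linearIndependent_iff.mp hα _ h0 m
      linarith
    subst hst
    have a := h2 j hij
    have b := h1 i hij
    rw [← le_div_iff₀ (hpos j hj)] at a
    rw [← lt_div_iff₀ (hpos i hi)] at b
    linarith
  refine ⟨?_, ?_⟩
  · intro i j hi hj hij
    rcases lt_or_gt_of_ne hij with h | h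
    · exact hlt i j hi hj h
    · exact (hlt j i hj hi h).symm
  · ext x
    simp only [Set.mem_iUnion, Set.mem_setOf_eq, exists_prop]
    constructor
    · rintro ⟨i, hi, hx⟩
      rw [hoCone_update_iff α e γ hγ' _ (hpos _ hi)] at hx
      obtain ⟨s, hs, h0, h1, h2⟩ := hx
      refine ⟨s, fun m _ => ?_, by simp, hs⟩
      have hq : 0 ≤ s i / e i * e m := mul_nonneg (div_nonneg h0 (hnn i)) (hnn m)
      rcases lt_trichotomy m i with h | h | h
      · exact hq.trans (h1 m h).le
      · rw [h]; exact h0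
      · exact hq.trans (h2 m h)
    · rintro ⟨s, h0, -, hs⟩
      have h0 : ∀ m, 0 ≤ s m := fun m => h0 m (by simp)
      obtain ⟨i, hi, hmin⟩ := Finset.exists_min_image
        (Finset.univ.filter (fun m : Fin n => (m : ℕ) < r))
        (fun m => toLex (s m / e m, m)) ⟨⟨0, by omega⟩, by simp; omega⟩
      have hi : (i : ℕ) < r := by simpa using hi
      refine ⟨i, hi, ?_⟩
      rw [hoCone_update_iff α e γ hγ' _ (hpos _ hi)]
      refine ⟨s, hs, h0 i, ?_, ?_⟩
      · intro m hm
        have hmr : (m : ℕ) < r := lt_trans hm hi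
        have := hmin m (by simpa using hmr)
        rw [← lt_div_iff₀ (hpos m hmr)]
        rcases (Prod.Lex.toLex_le_toLex).mp this with h | ⟨_, h⟩
        · exact h
        · exact absurd hm (not_lt.mpr h)
      · intro m hm
        by_cases hmr : (m : ℕ) < r
        · have := hmin m (by simpa using hmr)
          rw [← le_div_iff₀ (hpos m hmr)]
          rcases (Prod.Lex.toLex_le_toLex).mp this with h | ⟨h, _⟩
          · exact h.le
          · exact h.le
        · have : e m = 0 := by simp [he, hmr]
          rw [this, mul_zero]; exact h0 m
end
end

section
/- Let α₁,…,αₙ be linearly independent vectors in ℝ^d, let 1 ≤ r ≤ n, and normalize γ = α₁ + ⋯ + α_r. For each 1 ≤ ℓ ≤ r let C_ℓ := { Σ_{i=1}^n t_i α_i : t_i ≥ 0 for all i, t_j > t_ℓ for 1 ≤ j < ℓ, and t_j ≥ t_ℓ for ℓ < j ≤ r }. Then C_ℓ equals the half-open cone K_ℓ = 𝒞^{{1,…,ℓ−1}}(α₁,…,α_{ℓ−1},γ,α_{ℓ+1},…,αₙ); that is, a point Σ t_i α_i of 𝒞(α₁,…,αₙ) lies in K_ℓ if and only if ℓ is the smallest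 index at which the minimum of t₁,…,t_r is attained. -/
noncomputable section
open scoped BigOperators

lemma sum_update_aux {d n : ℕ} (α : Fin n → Fin d → ℝ) (r : ℕ) (γ : Fin d → ℝ)
    (hγ : γ = ∑ i ∈ Finset.univ.filter (fun i : Fin n => (i : ℕ) < r), α i)
    (ℓ : Fin n) (s t : Fin n → ℝ)
    (h : ∀ i, t i = (if (i : ℕ) < r then s ℓ else 0) + (if i = ℓ then 0 else s i)) :
    ∑ i, t i • α i = ∑ i, s i • Function.update α ℓ γ i := by
  have h1 : ∀ i, s i • Function.update α ℓ γ i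
      = (if i = ℓ then s ℓ • γ else 0) + (if i = ℓ then 0 else s i) • α i := by
    intro i
    by_cases hi : i = ℓ
    · subst hi; simp
    · simp [hi]
  simp only [h1, h, add_smul, Finset.sum_add_distrib]
  congr 1
  rw [Finset.sum_ite_eq' Finset.univ ℓ, hγ, Finset.smul_sum, Finset.sum_filter]
  simp [ite_smul]

/-- With `γ = α₁ + ⋯ + α_r` normalized, the piece `C_ℓ` (points `Σ tᵢαᵢ`, `tᵢ ≥ 0`,
whose first minimal coefficient among `t₁,…,t_r` occurs at index `ℓ`) equals the
half-open cone `K_ℓ = 𝒞^{{1,…,ℓ−1}}(α₁,…,α_{ℓ−1},γ,α_{ℓ+1},…,αₙ)`. -/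
theorem first_min_piece_eq_halfopen_cone {d n : ℕ} (α : Fin n → Fin d → ℝ)
    (hα : LinearIndependent ℝ α) (r : ℕ) (hr1 : 1 ≤ r) (hrn : r ≤ n)
    (γ : Fin d → ℝ)
    (hγ : γ = ∑ i ∈ Finset.univ.filter (fun i : Fin n => (i : ℕ) < r), α i)
    (ℓ : Fin n) (hℓ : (ℓ : ℕ) < r) :
    {x | ∃ t : Fin n → ℝ, (∀ i, 0 ≤ t i) ∧
        (∀ j : Fin n, (j : ℕ) < (ℓ : ℕ) → t ℓ < t j) ∧
        (∀ j : Fin n, (ℓ : ℕ) < (j : ℕ) → (j : ℕ) < r → t ℓ ≤ t j) ∧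
        x = ∑ i, t i • α i}
      = hoCone (Function.update α ℓ γ)
          (Finset.univ.filter (fun m : Fin n => (m : ℕ) < (ℓ : ℕ))) := by
  ext x
  simp only [hoCone, Set.mem_setOf_eq, Finset.mem_filter, Finset.mem_univ, true_and, not_lt]
  constructor
  · rintro ⟨t, h0, h1, h2, rfl⟩
    refine ⟨fun i => if i = ℓ then t ℓ else if (i : ℕ) < r then t i - t ℓ else t i,
      ?_, ?_, ?_⟩
    · intro i hi
      by_cases hil : i = ℓ
      · simp [hil, h0]
      · have hne : (ℓ : ℕ) < i := lt_of_le_of_ne hi (fun h => hil (Fin.ext h.symm))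
        by_cases hir : (i : ℕ) < r
        · simpa [hil, hir] using h2 i hne hir
        · simpa [hil, hir] using h0 i
    · intro i hi
      have hil : i ≠ ℓ := by rintro rfl; exact lt_irrefl _ hi
      have hir : (i : ℕ) < r := hi.trans hℓ
      simpa [hil, hir] using h1 i hi
    · apply sum_update_aux α r γ hγ ℓ
      intro i
      by_cases hil : i = ℓ
      · simp [hil, hℓ]
      · by_cases hir : (i : ℕ) < r <;> simp [hil, hir]
  · rintro ⟨s, h0, h1, rfl⟩
    have hs : ∀ i, 0 ≤ s i := fun i => by
      rcases lt_or_ge (i : ℕ) (ℓ : ℕ) with h | h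
      · exact (h1 i h).le
      · exact h0 i h
    refine ⟨fun i => (if (i : ℕ) < r then s ℓ else 0) + (if i = ℓ then 0 else s i),
      ?_, ?_, ?_, ?_⟩
    · intro i
      have := hs i
      have := hs ℓ
      dsimp only
      split_ifs <;> linarith
    · intro i hi
      have hil : i ≠ ℓ := by rintro rfl; exact lt_irrefl _ hi
      have hir : (i : ℕ) < r := hi.trans hℓ
      simpa [hil, hir, hℓ] using h1 i hi
    · intro i hi hir
      have hil : i ≠ ℓ := by rintro rfl; exact lt_irrefl _ hi
      simpa [hil, hir, hℓ] using hs i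
    · exact (sum_update_aux α r γ hγ ℓ s _ (fun i => rfl)).symm
end
end

section
/- Let α₁,…,αₙ be linearly independent vectors in ℝ^d and let 1 ≤ r ≤ n. For 1 ≤ i ≤ r−1 set F_i := 𝒞^{{1,…,i−1}}(α₁,…,α_{i−1},α_{i+1},…,αₙ), the half-open cone on the n−1 generators obtained by deleting α_i, with the facets indexed by 1,…,i−1 open. Then the closed cone K = 𝒞(α₁,…,αₙ) is the disjoint union of F₁,…,F_{r−1} and the half-open cone 𝒞^{{1,…,r−1}}(α₁,…,αₙ); equivalently, K \ 𝒞^{{1,…,r−1}}(α₁,…,αₙ) is the disjoint union of F₁,…,F_{r−1}. -/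
noncomputable section
open scoped BigOperators

theorem face_mem_iff {d n : ℕ} (α : Fin (n + 1) → Fin d → ℝ) (i : Fin (n + 1))
    (x : Fin d → ℝ) :
    x ∈ hoCone (fun m : Fin n => α (i.succAbove m))
          (Finset.univ.filter (fun m : Fin n => (m : ℕ) < (i : ℕ))) ↔
      ∃ t : Fin (n + 1) → ℝ, t i = 0 ∧ (∀ j, 0 ≤ t j) ∧ (∀ j, j < i → 0 < t j) ∧
        x = ∑ j, t j • α j := by
  constructor
  · rintro ⟨t, h0, h1, hx⟩
    have h2 : ∀ m, 0 ≤ t m := by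
      intro m
      by_cases hm : m ∈ Finset.univ.filter (fun m : Fin n => (m : ℕ) < (i : ℕ))
      · exact (h1 m hm).le
      · exact h0 m hm
    refine ⟨i.insertNth (α := fun _ => ℝ) 0 t, by simp, ?_, ?_, ?_⟩
    · intro j
      rcases Fin.eq_self_or_eq_succAbove i j with rfl | ⟨m, rfl⟩
      · simp
      · simpa using h2 m
    · intro j hj
      rcases Fin.eq_self_or_eq_succAbove i j with rfl | ⟨m, rfl⟩
      · exact absurd hj (lt_irrefl _)
      · rw [Fin.insertNth_apply_succAbove]
        apply h1
        rw [Fin.succAbove_lt_iff_castSucc_lt] at hj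
        simpa [Fin.lt_def] using hj
    · rw [Fin.sum_univ_succAbove _ i]
      simpa using hx
  · rintro ⟨t, hi, h0, h1, hx⟩
    refine ⟨fun m => t (i.succAbove m), fun m _ => h0 _, ?_, ?_⟩
    · intro m hm
      apply h1
      rw [Fin.succAbove_lt_iff_castSucc_lt]
      simpa [Fin.lt_def] using hm
    · rw [Fin.sum_univ_succAbove _ i] at hx
      simpa [hi] using hx

theorem coeff_unique {d n : ℕ} {α : Fin n → Fin d → ℝ} (hα : LinearIndependent ℝ α)
    {s t : Fin n → ℝ} (h : ∑ i, s i • α i = ∑ i, t i • α i) (i : Fin n) : s i = t i := by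
  have := Fintype.linearIndependent_iff.1 hα (fun i => s i - t i)
    (by simp [sub_smul, Finset.sum_sub_distrib, h]) i
  linarith

/-- Lemma 3.8: the closed cone `K = 𝒞(α₁,…,αₙ)` is the disjoint union of the faces
`Fᵢ = 𝒞^{{1,…,i−1}}(A[(i→0)])` for `1 ≤ i ≤ r−1` together with the half-open cone
`𝒞^{{1,…,r−1}}(A)`. -/
theorem face_partition {d n : ℕ} (α : Fin (n + 1) → Fin d → ℝ)
    (hα : LinearIndependent ℝ α) (r : ℕ) (hr1 : 1 ≤ r) (hrn : r ≤ n + 1) :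
    (∀ i j : Fin (n + 1), (i : ℕ) + 1 < r → (j : ℕ) + 1 < r → i ≠ j →
      Disjoint
        (hoCone (fun m : Fin n => α (i.succAbove m))
          (Finset.univ.filter (fun m : Fin n => (m : ℕ) < (i : ℕ))))
        (hoCone (fun m : Fin n => α (j.succAbove m))
          (Finset.univ.filter (fun m : Fin n => (m : ℕ) < (j : ℕ))))) ∧
    (∀ i : Fin (n + 1), (i : ℕ) + 1 < r →
      Disjoint
        (hoCone (fun m : Fin n => α (i.succAbove m))
          (Finset.univ.filter (fun m : Fin n => (m : ℕ) < (i : ℕ))))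
        (hoCone α (Finset.univ.filter (fun m : Fin (n + 1) => (m : ℕ) + 1 < r)))) ∧
    ((⋃ i ∈ {i : Fin (n + 1) | (i : ℕ) + 1 < r},
        hoCone (fun m : Fin n => α (i.succAbove m))
          (Finset.univ.filter (fun m : Fin n => (m : ℕ) < (i : ℕ)))) ∪
      hoCone α (Finset.univ.filter (fun m : Fin (n + 1) => (m : ℕ) + 1 < r))
      = hoCone α ∅) := by
  refine ⟨?_, ?_, ?_⟩
  · intro i j _ _ hij
    rw [Set.disjoint_left]
    intro x hx hy
    obtain ⟨s, hs, -, hs1, hxs⟩ := (face_mem_iff α i x).1 hx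
    obtain ⟨t, ht, -, ht1, hxt⟩ := (face_mem_iff α j x).1 hy
    have he := coeff_unique hα (hxs.symm.trans hxt)
    rcases lt_or_gt_of_ne hij with h | h
    · have := ht1 i h
      rw [← he, hs] at this
      exact lt_irrefl _ this
    · have := hs1 j h
      rw [he, ht] at this
      exact lt_irrefl _ this
  · intro i hi
    rw [Set.disjoint_left]
    intro x hx hy
    obtain ⟨s, hs, -, hs1, hxs⟩ := (face_mem_iff α i x).1 hx
    obtain ⟨t, -, ht, hxt⟩ := hy
    have he := coeff_unique hα (hxs.symm.trans hxt)
    have := ht i (by simpa using hi)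
    rw [← he, hs] at this
    exact lt_irrefl _ this
  · ext x
    simp only [Set.mem_union, Set.mem_iUnion, Set.mem_setOf_eq, face_mem_iff, exists_prop]
    constructor
    · rintro (⟨i, -, t, -, h0, -, hx⟩ | ⟨t, h0, h1, hx⟩)
      · exact ⟨t, fun j _ => h0 j, by simp, hx⟩
      · refine ⟨t, fun j _ => ?_, by simp, hx⟩
        by_cases hj : j ∈ Finset.univ.filter (fun m : Fin (n + 1) => (m : ℕ) + 1 < r)
        · exact (h1 j hj).le
        · exact h0 j hj
    · rintro ⟨t, h0, -, hx⟩
      have h0 : ∀ j, 0 ≤ t j := fun j => h0 j (by simp)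
      by_cases hz : ∃ i : Fin (n + 1), (i : ℕ) + 1 < r ∧ t i = 0
      · left
        obtain ⟨i, ⟨hi, hti⟩, hmin⟩ := WellFounded.has_min (wellFounded_lt (α := Fin (n + 1)))
          {i : Fin (n + 1) | (i : ℕ) + 1 < r ∧ t i = 0} hz
        refine ⟨i, hi, t, hti, h0, fun j hj => ?_, hx⟩
        refine lt_of_le_of_ne (h0 j) fun h => hmin j ⟨?_, h.symm⟩ hj
        have : (j : ℕ) < i := hj
        omega
      · right
        refine ⟨t, fun j _ => h0 j, fun j hj => ?_, hx⟩
        refine lt_of_le_of_ne (h0 j) fun h => hz ⟨j, by simpa using hj, h.symm⟩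
end
end

section
/- Let F be a field, let r ≥ 1 and 0 ≤ k ≤ r, and let u₁,…,u_r ∈ F satisfy u_i ≠ 0 and u_i ≠ 1 for all i. Set g := u₁⋯u_k · (u_{k+1}⋯u_r)⁻¹ and assume g ≠ 1. Then 1/∏_{i=1}^r (1 − u_i) = L₁ + L₂, where L₁ = Σ_{j=1}^{k} (−1)^{j−1} / [ (1 − g) · ∏_{i=1}^{j−1}(1 − u_i⁻¹) · ∏_{i=j+1}^{r}(1 − u_i) ] and L₂ = Σ_{j=k+1}^{r} (−1)^{j−(k+1)} / [ (1 − g⁻¹) · ∏_{i=1}^{k}(1 − u_i) · ∏_{i=k+1}^{j−1}(1 − u_i⁻¹) · ∏_{i=j+1}^{r}(1 − u_i) ]. -/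
lemma aux_split {F : Type*} [Field F] (f : ℕ → F) (a b r : ℕ) (hab : a ≤ b) (hbr : b ≤ r) :
    ∏ i ∈ Finset.Icc (a + 1) r, f i =
      (∏ i ∈ Finset.Icc (a + 1) b, f i) * ∏ i ∈ Finset.Icc (b + 1) r, f i := by
  have e : ∀ x y : ℕ, Finset.Icc (x + 1) y = Finset.Ioc x y := by
    intro x y; ext i; simp only [Finset.mem_Icc, Finset.mem_Ioc]; omega
  simp only [e]
  exact (Finset.prod_Ioc_consecutive f hab hbr).symm

lemma aux_sign {F : Type*} [Field F] (u : ℕ → F) (a n : ℕ)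
    (hu : ∀ i ∈ Finset.Icc (a + 1) (a + n), u i ≠ 0) :
    (-1 : F) ^ n * ∏ i ∈ Finset.Icc (a + 1) (a + n), (1 - u i) =
      (∏ i ∈ Finset.Icc (a + 1) (a + n), (1 - (u i)⁻¹)) *
        ∏ i ∈ Finset.Icc (a + 1) (a + n), u i := by
  have hc : (-1 : F) ^ n = ∏ i ∈ Finset.Icc (a + 1) (a + n), (-1 : F) := by
    simp
  rw [hc, ← Finset.prod_mul_distrib, ← Finset.prod_mul_distrib]
  refine Finset.prod_congr rfl fun i hi => ?_
  have := hu i hi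
  field_simp
  ring

lemma aux_sum {F : Type*} [Field F] (u : ℕ → F) (a r : ℕ) (c : F)
    (hu : ∀ i ∈ Finset.Icc (a + 1) r, u i ≠ 0 ∧ u i ≠ 1) (hc : c ≠ 0) (n : ℕ) (hn : a + n ≤ r) :
    ∑ j ∈ Finset.Icc (a + 1) (a + n), (-1 : F) ^ (j - (a + 1)) /
        (c * (∏ i ∈ Finset.Icc (a + 1) (j - 1), (1 - (u i)⁻¹)) *
          ∏ i ∈ Finset.Icc (j + 1) r, (1 - u i)) =
      (1 - ∏ i ∈ Finset.Icc (a + 1) (a + n), u i) /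
        (c * ∏ i ∈ Finset.Icc (a + 1) r, (1 - u i)) := by
  induction n with
  | zero => simp
  | succ n ih =>
    rw [← add_assoc, Finset.sum_Icc_succ_top (by omega), Finset.prod_Icc_succ_top (by omega),
      ih (by omega)]
    have h1 : a + n + 1 - (a + 1) = n := by omega
    have h2 : a + n + 1 - 1 = a + n := by omega
    rw [h1, h2, aux_split (fun i => 1 - u i) a (a + n + 1) r (by omega) (by omega),
      Finset.prod_Icc_succ_top (by omega)]
    have hs := aux_sign u a n (fun i hi => (hu i (by
      simp only [Finset.mem_Icc] at hi ⊢; omega)).1)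
    have hQ : ∏ i ∈ Finset.Icc (a + 1) (a + n), (1 - u i) ≠ 0 :=
      Finset.prod_ne_zero_iff.2 fun i hi => sub_ne_zero.2 (hu i (by
        simp only [Finset.mem_Icc] at hi ⊢; omega)).2.symm
    have hR : ∏ i ∈ Finset.Icc (a + n + 1 + 1) r, (1 - u i) ≠ 0 :=
      Finset.prod_ne_zero_iff.2 fun i hi => sub_ne_zero.2 (hu i (by
        simp only [Finset.mem_Icc] at hi ⊢; omega)).2.symm
    have hx : 1 - u (a + n + 1) ≠ 0 := sub_ne_zero.2 (hu _ (by
        simp only [Finset.mem_Icc]; omega)).2.symm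
    have hV : ∏ i ∈ Finset.Icc (a + 1) (a + n), (1 - (u i)⁻¹) ≠ 0 := by
      intro h
      rw [h, zero_mul] at hs
      exact mul_ne_zero (pow_ne_zero _ (neg_ne_zero.2 one_ne_zero)) hQ hs
    generalize ∏ i ∈ Finset.Icc (a + 1) (a + n), (1 - u i) = Q at *
    generalize ∏ i ∈ Finset.Icc (a + n + 1 + 1) r, (1 - u i) = R at *
    generalize ∏ i ∈ Finset.Icc (a + 1) (a + n), (1 - (u i)⁻¹) = V at *
    generalize ∏ i ∈ Finset.Icc (a + 1) (a + n), u i = U at *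
    generalize u (a + n + 1) = x at *
    generalize (-1 : F) ^ n = s at *
    have hs' : s = V * U / Q := by rw [eq_div_iff hQ, hs]
    subst hs'
    field_simp
    ring

/-- Lemma 3.11 (partial-fraction decomposition of `1/∏(1−uᵢ)` in a field). -/
theorem fraction_decomposition {F : Type*} [Field F] (r k : ℕ) (hr : 1 ≤ r)
    (hk : k ≤ r) (u : ℕ → F)
    (hu : ∀ i ∈ Finset.Icc 1 r, u i ≠ 0 ∧ u i ≠ 1)
    (g : F) (hg : g = (∏ i ∈ Finset.Icc 1 k, u i) * (∏ i ∈ Finset.Icc (k + 1) r, u i)⁻¹)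
    (hg1 : g ≠ 1) :
    (∏ i ∈ Finset.Icc 1 r, (1 - u i))⁻¹ =
      (∑ j ∈ Finset.Icc 1 k,
        (-1 : F) ^ (j - 1) /
          ((1 - g) * (∏ i ∈ Finset.Icc 1 (j - 1), (1 - (u i)⁻¹)) *
            ∏ i ∈ Finset.Icc (j + 1) r, (1 - u i)))
    + (∑ j ∈ Finset.Icc (k + 1) r,
        (-1 : F) ^ (j - (k + 1)) /
          ((1 - g⁻¹) * (∏ i ∈ Finset.Icc 1 k, (1 - u i)) *
            (∏ i ∈ Finset.Icc (k + 1) (j - 1), (1 - (u i)⁻¹)) *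
            ∏ i ∈ Finset.Icc (j + 1) r, (1 - u i))) := by
  have hA : ∏ i ∈ Finset.Icc 1 k, u i ≠ 0 :=
    Finset.prod_ne_zero_iff.2 fun i hi => (hu i (by
      simp only [Finset.mem_Icc] at hi ⊢; omega)).1
  have hB : ∏ i ∈ Finset.Icc (k + 1) r, u i ≠ 0 :=
    Finset.prod_ne_zero_iff.2 fun i hi => (hu i (by
      simp only [Finset.mem_Icc] at hi ⊢; omega)).1
  have hP : ∏ i ∈ Finset.Icc 1 k, (1 - u i) ≠ 0 :=
    Finset.prod_ne_zero_iff.2 fun i hi => sub_ne_zero.2 (hu i (by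
      simp only [Finset.mem_Icc] at hi ⊢; omega)).2.symm
  have hQ : ∏ i ∈ Finset.Icc (k + 1) r, (1 - u i) ≠ 0 :=
    Finset.prod_ne_zero_iff.2 fun i hi => sub_ne_zero.2 (hu i (by
      simp only [Finset.mem_Icc] at hi ⊢; omega)).2.symm
  have hg2 : 1 - g ≠ 0 := sub_ne_zero.2 hg1.symm
  have hg3 : 1 - g⁻¹ ≠ 0 := sub_ne_zero.2 fun h => hg1 (inv_eq_one.1 h.symm)
  have e1 := aux_sum u 0 r (1 - g) (by simpa using hu) hg2 k (by omega)
  have e2 := aux_sum u k r ((1 - g⁻¹) * ∏ i ∈ Finset.Icc 1 k, (1 - u i))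
    (fun i hi => hu i (by simp only [Finset.mem_Icc] at hi ⊢; omega))
    (mul_ne_zero hg3 hP) (r - k) (by omega)
  have hs := aux_split (fun i => 1 - u i) 0 k r (by omega) hk
  rw [Nat.add_sub_cancel' hk] at e2
  simp only [zero_add] at e1 hs
  rw [e1, e2, hs]
  generalize ∏ i ∈ Finset.Icc 1 k, (1 - u i) = P at *
  generalize ∏ i ∈ Finset.Icc (k + 1) r, (1 - u i) = Q at *
  generalize ∏ i ∈ Finset.Icc 1 k, u i = A at *
  generalize ∏ i ∈ Finset.Icc (k + 1) r, u i = B at *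
  clear e1 e2 hs hu
  have hBA : B - A ≠ 0 := by
    intro h
    apply hg1
    rw [hg, ← sub_eq_zero.1 h, mul_inv_cancel₀ hB]
  have hAB : A - B ≠ 0 := by
    intro h
    apply hBA
    rw [← neg_sub, h, neg_zero]
  have f1 : 1 - g = (B - A) / B := by rw [hg]; field_simp
  have f2 : 1 - g⁻¹ = -(B - A) / A := by rw [hg]; field_simp; ring
  rw [f1, f2]
  field_simp
  ring
end
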